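/- Let H be a complex Hilbert space, let n be a positive natural number, let {ξ₁, …, ξₙ} be an orthonormal system in H, and let aₙ = ∑_{k=1}^n (1/n) ξ_k ⊗ ξ_k. Then ‖aₙ‖₁ = 1, ‖aₙ‖_∞ = 1/n, and λ(aₙ) = 1/n. -/

import Mathlib

/-! Setting: `H` is a complex Hilbert space, and we consider the space `C₁(H)` of trace class
operators on `H` (more generally the Schatten classes `C_p(H)`), regarded as those bounded
operators `a : H →L[ℂ] H` that are compact and whose sequence of singular values is
`p`-summable. The singular values `μₙ(a)` of a compact operator `a` (the eigenvalues of
`|a| = (a^* a)^(1/2)` arranged in decreasing order and repeated according to multiplicity)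
are realized here via the approximation numbers, which coincide with them. -/

/-- `sValue a n` is the `n`-th approximation number (`0`-indexed) of `a`, namely the distance
from `a` to the operators of rank at most `n`.  For a compact operator on a Hilbert space this
coincides with the `(n+1)`-th singular value `μ_{n+1}(a)`, i.e. the `(n+1)`-th eigenvalue of
`|a| = (a^* a)^(1/2)` arranged in decreasing order and repeated according to multiplicity.  In
particular `sValue a 0 = μ₁(a) = ‖a‖`. -/
noncomputable def sValue {H : Type*} [NormedAddCommGroup H] [InnerProductSpace ℂ H]
    (a : H →L[ℂ] H) (n : ℕ) : ℝ :=
  sInf {r : ℝ | ∃ F : H →L[ℂ] H, LinearMap.rank (F : H →ₗ[ℂ] H) ≤ (n : Cardinal) ∧ r = ‖a - F‖}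

/-- Membership in the Schatten class `C_p(H)`: `a` is a compact operator with
`‖a‖_p^p = ∑ₙ μₙ(a)^p < ∞`. -/
def MemSchatten {H : Type*} [NormedAddCommGroup H] [InnerProductSpace ℂ H]
    (p : ℝ) (a : H →L[ℂ] H) : Prop :=
  IsCompactOperator a ∧ Summable (fun n => sValue a n ^ p)

/-- Membership in the trace class `C₁(H)`: `a` is a compact operator with
`‖a‖₁ = tr |a| = ∑ₙ μₙ(a) < ∞`. -/
def MemTraceClass {H : Type*} [NormedAddCommGroup H] [InnerProductSpace ℂ H]
    (a : H →L[ℂ] H) : Prop :=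
  IsCompactOperator a ∧ Summable (fun n => sValue a n)

/-- The trace norm `‖a‖₁ = tr |a| = ∑ₙ μₙ(a)`. -/
noncomputable def traceNorm {H : Type*} [NormedAddCommGroup H] [InnerProductSpace ℂ H]
    (a : H →L[ℂ] H) : ℝ :=
  ∑' n, sValue a n

/-- The closed unit ball of `C₁(H)` with respect to the trace norm `‖·‖₁`. -/
def traceBall (H : Type*) [NormedAddCommGroup H] [InnerProductSpace ℂ H] :
    Set (H →L[ℂ] H) :=
  {x | MemTraceClass x ∧ traceNorm x ≤ 1}

/-- The λ-function of Aron and Lohman on the closed unit ball of `C₁(H)`: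
`λ(a) = sup { t : (e, y, t) ∈ ∂ₑ(B) × B × [0,1] is a triplet amenable to a }`,
where a triplet `(e, y, t)` is amenable to `a` when `a = t • e + (1 - t) • y`. -/
noncomputable def lambdaFn {H : Type*} [NormedAddCommGroup H] [InnerProductSpace ℂ H]
    (a : H →L[ℂ] H) : ℝ :=
  sSup {t : ℝ | t ∈ Set.Icc (0 : ℝ) 1 ∧
    ∃ e ∈ Set.extremePoints ℝ (traceBall H), ∃ y ∈ traceBall H, a = t • e + (1 - t) • y}

/-- A minimal (i.e. rank-one) partial isometry: `e e^* e = e` and `e` has rank one. -/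
def IsMinimalPartialIsometry {H : Type*} [NormedAddCommGroup H] [InnerProductSpace ℂ H]
    [CompleteSpace H] (e : H →L[ℂ] H) : Prop :=
  e ∘L (ContinuousLinearMap.adjoint e) ∘L e = e ∧ LinearMap.rank (e : H →ₗ[ℂ] H) = 1

/-- The rank one operator `η ⊗ ξ : ζ ↦ ⟨ζ, ξ⟩ η` (Mathlib's inner product being conjugate
linear in the first variable, this is `ζ ↦ ⟪ξ, ζ⟫ • η`). -/
noncomputable def rankOneOp {H : Type*} [NormedAddCommGroup H] [InnerProductSpace ℂ H]
    (η ξ : H) : H →L[ℂ] H :=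
  (innerSL ℂ ξ).smulRight η


section

variable {H : Type*} [NormedAddCommGroup H] [InnerProductSpace ℂ H]

open Module Filter Topology
open scoped InnerProductSpace

theorem rankOneOp_apply (η ξ x : H) : rankOneOp η ξ x = ⟪ξ, x⟫_ℂ • η := rfl

theorem rank_rankOneOp_le (η ξ : H) : LinearMap.rank (rankOneOp η ξ : H →ₗ[ℂ] H) ≤ 1 := by
  have h : LinearMap.range (rankOneOp η ξ : H →ₗ[ℂ] H) ≤ Submodule.span ℂ {η} := by
    rintro _ ⟨x, rfl⟩
    exact Submodule.smul_mem _ _ (Submodule.mem_span_singleton_self η)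
  exact (Submodule.rank_mono h).trans ((rank_span_le _).trans (by simp))

theorem isCompactOperator_rankOneOp (η ξ : H) : IsCompactOperator (rankOneOp η ξ) :=
  ((isCompactOperator_id (E := ℂ)).comp_clm (innerSL ℂ ξ)).clm_comp
    (ContinuousLinearMap.toSpanSingleton ℂ η)

theorem bddBelow_sValue_set (a : H →L[ℂ] H) (k : ℕ) :
    BddBelow {r : ℝ | ∃ F : H →L[ℂ] H,
      LinearMap.rank (F : H →ₗ[ℂ] H) ≤ (k : Cardinal) ∧ r = ‖a - F‖} :=
  ⟨0, by rintro _ ⟨F, -, rfl⟩; positivity⟩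

theorem sValue_le (a F : H →L[ℂ] H) {k : ℕ}
    (hF : LinearMap.rank (F : H →ₗ[ℂ] H) ≤ (k : Cardinal)) : sValue a k ≤ ‖a - F‖ :=
  csInf_le (bddBelow_sValue_set a k) ⟨F, hF, rfl⟩

theorem le_sValue_of_forall {a : H →L[ℂ] H} {k : ℕ} {c : ℝ}
    (h : ∀ F : H →L[ℂ] H, LinearMap.rank (F : H →ₗ[ℂ] H) ≤ (k : Cardinal) → c ≤ ‖a - F‖) :
    c ≤ sValue a k := by
  refine le_csInf ⟨‖a - 0‖, 0, by simp, rfl⟩ ?_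
  rintro _ ⟨F, hF, rfl⟩
  exact h F hF

theorem sValue_nonneg (a : H →L[ℂ] H) (k : ℕ) : 0 ≤ sValue a k :=
  le_sValue_of_forall fun _ _ => norm_nonneg _

theorem sValue_le_norm (a : H →L[ℂ] H) (k : ℕ) : sValue a k ≤ ‖a‖ := by
  simpa using sValue_le a 0 (k := k) (by simp)

theorem sValue_zero (a : H →L[ℂ] H) : sValue a 0 = ‖a‖ := by
  refine (sValue_le_norm a 0).antisymm (le_sValue_of_forall fun F hF => ?_)
  have h0 : F = 0 := by
    have h := hF
    rw [Nat.cast_zero, nonpos_iff_eq_zero, LinearMap.rank, Submodule.rank_eq_zero,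
      LinearMap.range_eq_bot] at h
    ext x
    exact LinearMap.congr_fun h x
  simp [h0]

theorem rank_smul_le (c : ℝ) (F : H →L[ℂ] H) :
    LinearMap.rank ((c • F : H →L[ℂ] H) : H →ₗ[ℂ] H) ≤ LinearMap.rank (F : H →ₗ[ℂ] H) := by
  refine Submodule.rank_mono ?_
  rintro _ ⟨x, rfl⟩
  exact ⟨(c : ℂ) • x, by simp⟩

theorem sValue_smul_le (c : ℝ) (a : H →L[ℂ] H) (k : ℕ) :
    |c| * sValue a k ≤ sValue (c • a) k := by
  refine le_sValue_of_forall fun F hF => ?_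
  rcases eq_or_ne c 0 with rfl | hc
  · simp
  have h := sValue_le a (c⁻¹ • F) ((rank_smul_le c⁻¹ F).trans hF)
  calc |c| * sValue a k ≤ |c| * ‖a - c⁻¹ • F‖ := by gcongr
    _ = ‖c • a - F‖ := by
      rw [← Real.norm_eq_abs, ← norm_smul, smul_sub, smul_inv_smul₀ hc]

theorem sValue_smul (c : ℝ) (a : H →L[ℂ] H) (k : ℕ) :
    sValue (c • a) k = |c| * sValue a k := by
  refine le_antisymm ?_ (sValue_smul_le c a k)
  rcases eq_or_ne c 0 with rfl | hc
  · simpa using sValue_le_norm (0 : H →L[ℂ] H) k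
  have h := sValue_smul_le c⁻¹ (c • a) k
  rwa [inv_smul_smul₀ hc, abs_inv, inv_mul_le_iff₀ (abs_pos.2 hc)] at h

/-- The easy half of the Courant-Fischer principle. -/
theorem le_sValue_of_subspace {a : H →L[ℂ] H} {k : ℕ} {c : ℝ} (V : Submodule ℂ H)
    (hV : k < finrank ℂ V) (h : ∀ v ∈ V, c * ‖v‖ ≤ ‖a v‖) : c ≤ sValue a k := by
  refine le_sValue_of_forall fun F hF => ?_
  have : FiniteDimensional ℂ V := FiniteDimensional.of_finrank_pos (by omega)
  have : FiniteDimensional ℂ (LinearMap.range (F : H →ₗ[ℂ] H)) :=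
    Module.rank_lt_aleph0_iff.1 (hF.trans_lt Cardinal.natCast_lt_aleph0)
  have hk : finrank ℂ (LinearMap.range (F : H →ₗ[ℂ] H)) ≤ k := finrank_le_of_rank_le hF
  have hker : LinearMap.ker ((F : H →ₗ[ℂ] H).rangeRestrict ∘ₗ V.subtype) ≠ ⊥ :=
    LinearMap.ker_ne_bot_of_finrank_lt (by omega)
  obtain ⟨v, hv, hv0⟩ := Submodule.exists_mem_ne_zero_of_ne_bot hker
  have hFv : F v = 0 := congrArg Subtype.val (LinearMap.mem_ker.1 hv)
  have hpos : 0 < ‖(v : H)‖ := by simpa using hv0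
  refine le_of_mul_le_mul_right ?_ hpos
  calc c * ‖(v : H)‖ ≤ ‖a v‖ := h v v.2
    _ = ‖(a - F) v‖ := by simp [hFv]
    _ ≤ ‖a - F‖ * ‖(v : H)‖ := (a - F).le_opNorm v

theorem eq_of_re_inner_eq_one {u w : H} (hu : ‖u‖ ≤ 1) (hw : ‖w‖ ≤ 1)
    (h : (⟪u, w⟫_ℂ).re = 1) : u = w := by
  have h1 := norm_sub_sq (𝕜 := ℂ) u w
  rw [RCLike.re_eq_complex_re, h] at h1
  have h2 : ‖u - w‖ = 0 := by
    nlinarith [norm_nonneg u, norm_nonneg w, norm_nonneg (u - w), sq_nonneg ‖u - w‖]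
  exact sub_eq_zero.1 (norm_eq_zero.1 h2)

/-- Subtract from `a` its rank-one component along `v`. -/
noncomputable def deflation (a : H →L[ℂ] H) (v : H) : H →L[ℂ] H :=
  a - rankOneOp (a v) v

theorem deflation_apply (a : H →L[ℂ] H) (v x : H) :
    deflation a v x = a (x - ⟪v, x⟫_ℂ • v) := by
  simp [deflation, rankOneOp_apply]

theorem isCompactOperator_deflation {a : H →L[ℂ] H} (ha : IsCompactOperator a) (v : H) :
    IsCompactOperator (deflation a v) :=
  ha.sub (isCompactOperator_rankOneOp _ _)

theorem sValue_succ_le_sValue_deflation (a : H →L[ℂ] H) (v : H) (k : ℕ) :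
    sValue a (k + 1) ≤ sValue (deflation a v) k := by
  refine le_sValue_of_forall fun F hF => ?_
  have h := sValue_le a (rankOneOp (a v) v + F) (k := k + 1) <| by
    refine (LinearMap.rank_add_le _ _).trans ?_
    rw [Nat.cast_succ, add_comm]
    exact add_le_add hF (rank_rankOneOp_le _ _)
  rwa [← sub_sub] at h

theorem norm_rankOneOp (η ξ : H) : ‖rankOneOp η ξ‖ = ‖η‖ * ‖ξ‖ :=
  InnerProductSpace.norm_rankOne (𝕜 := ℂ) η ξ

theorem MemTraceClass.norm_le_traceNorm {a : H →L[ℂ] H} (ha : MemTraceClass a) :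
    ‖a‖ ≤ traceNorm a := by
  rw [← sValue_zero]
  exact ha.2.le_tsum 0 fun k _ => sValue_nonneg a k

theorem MemTraceClass.smul {a : H →L[ℂ] H} (ha : MemTraceClass a) (c : ℝ) :
    MemTraceClass (c • a) := by
  refine ⟨ha.1.smul c, ?_⟩
  simp only [sValue_smul]
  exact ha.2.mul_left _

theorem traceNorm_smul (c : ℝ) (a : H →L[ℂ] H) : traceNorm (c • a) = |c| * traceNorm a := by
  simp only [traceNorm, sValue_smul, tsum_mul_left]

theorem mem_traceBall_of_rank_le_one {a : H →L[ℂ] H}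
    (ha : LinearMap.rank (a : H →ₗ[ℂ] H) ≤ 1) (hc : IsCompactOperator a) (hn : ‖a‖ ≤ 1) :
    a ∈ traceBall H := by
  have h0 : ∀ k, k ∉ Finset.range 1 → sValue a k = 0 := fun k hk => by
    refine le_antisymm ?_ (sValue_nonneg a k)
    have hk1 : 1 ≤ k := by simpa [Nat.one_le_iff_ne_zero] using hk
    simpa using sValue_le a a (k := k) (ha.trans (by exact_mod_cast hk1))
  refine ⟨⟨hc, summable_of_ne_finset_zero h0⟩, ?_⟩
  rw [traceNorm, tsum_eq_sum h0]
  simpa [sValue_zero] using hn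

theorem rankOneOp_mem_traceBall {η ξ : H} (hη : ‖η‖ = 1) (hξ : ‖ξ‖ = 1) :
    rankOneOp η ξ ∈ traceBall H :=
  mem_traceBall_of_rank_le_one (rank_rankOneOp_le η ξ) (isCompactOperator_rankOneOp η ξ)
    (by rw [norm_rankOneOp, hη, hξ, mul_one])

variable {ι : Type*} [Fintype ι]

theorem Orthonormal.sum_norm_inner_rankOneOp_le {b : ι → H} (hb : Orthonormal ℂ b) (η ξ : H) :
    ∑ i, ‖⟪b i, rankOneOp η ξ (b i)⟫_ℂ‖ ≤ ‖η‖ * ‖ξ‖ := by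
  have h : ∀ i, ‖⟪b i, rankOneOp η ξ (b i)⟫_ℂ‖ = ‖⟪b i, η⟫_ℂ‖ * ‖⟪b i, ξ⟫_ℂ‖ := fun i => by
    rw [rankOneOp_apply, inner_smul_right, norm_mul, norm_inner_symm, mul_comm]
  simp only [h]
  refine (Real.sum_mul_le_sqrt_mul_sqrt _ _ _).trans ?_
  gcongr
  · exact Real.sqrt_le_iff.2 ⟨norm_nonneg _, hb.sum_inner_products_le η⟩
  · exact Real.sqrt_le_iff.2 ⟨norm_nonneg _, hb.sum_inner_products_le ξ⟩

theorem Orthonormal.sum_rankOneOp_eq_starProjection {b : ι → H} (hb : Orthonormal ℂ b)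
    [(Submodule.span ℂ (Set.range b)).HasOrthogonalProjection] :
    ∑ i, rankOneOp (b i) (b i) = (Submodule.span ℂ (Set.range b)).starProjection := by
  classical
  ext x
  refine (Submodule.eq_starProjection_of_mem_of_inner_eq_zero ?_ fun w hw => ?_).symm
  · rw [sum_apply]
    exact Submodule.sum_mem _ fun i _ =>
      Submodule.smul_mem _ _ (Submodule.subset_span ⟨i, rfl⟩)
  · induction hw using Submodule.span_induction with
    | mem w hw =>
      obtain ⟨j, rfl⟩ := hw
      simp only [sum_apply, rankOneOp_apply]
      rw [inner_sub_left, sum_inner]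
      simp [inner_smul_left, orthonormal_iff_ite.1 hb]
    | zero => simp
    | add u w _ _ hu hw => rw [inner_add_right, hu, hw, add_zero]
    | smul c w _ hw => rw [inner_smul_right, hw, mul_zero]

theorem sValue_smul_starProjection (S : Submodule ℂ H) [FiniteDimensional ℂ S] {c : ℝ}
    (hc : 0 ≤ c) (k : ℕ) :
    sValue (c • S.starProjection) k = if k < finrank ℂ S then c else 0 := by
  rw [sValue_smul, abs_of_nonneg hc]
  split_ifs with hk
  · suffices h : sValue S.starProjection k = 1 by rw [h, mul_one]
    refine ((sValue_le_norm _ k).trans S.starProjection_norm_le).antisymm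
      (le_sValue_of_subspace S hk fun v hv => ?_)
    rw [Submodule.starProjection_eq_self_iff.2 hv, one_mul]
  · suffices h : sValue S.starProjection k = 0 by rw [h, mul_zero]
    refine le_antisymm ?_ (sValue_nonneg _ k)
    refine (sValue_le _ S.starProjection ?_).trans (by simp)
    have h1 : LinearMap.range (S.starProjection : H →ₗ[ℂ] H) ≤ S := by
      rintro _ ⟨x, rfl⟩
      exact S.starProjection_apply_mem x
    refine (Submodule.rank_mono h1).trans ?_
    rw [← finrank_eq_rank]
    exact_mod_cast not_lt.1 hk

theorem isCompactOperator_starProjection (S : Submodule ℂ H) [FiniteDimensional ℂ S] :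
    IsCompactOperator S.starProjection := by
  have : ProperSpace S := FiniteDimensional.proper ℂ S
  exact ((isCompactOperator_id (E := S)).comp_clm S.orthogonalProjectionOnto).clm_comp S.subtypeL

theorem memTraceClass_smul_starProjection (S : Submodule ℂ H) [FiniteDimensional ℂ S] {c : ℝ}
    (hc : 0 ≤ c) : MemTraceClass (c • S.starProjection) := by
  refine ⟨(isCompactOperator_starProjection S).smul c,
    summable_of_ne_finset_zero (s := Finset.range (finrank ℂ S)) fun k hk => ?_⟩
  rw [sValue_smul_starProjection S hc, if_neg (by simpa using hk)]

theorem traceNorm_smul_starProjection (S : Submodule ℂ H) [FiniteDimensional ℂ S] {c : ℝ}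
    (hc : 0 ≤ c) : traceNorm (c • S.starProjection) = finrank ℂ S * c := by
  simp only [traceNorm, sValue_smul_starProjection S hc]
  rw [tsum_eq_sum (s := Finset.range (finrank ℂ S)) fun k hk => if_neg (by simpa using hk),
    Finset.sum_congr rfl fun k hk => if_pos (Finset.mem_range.1 hk)]
  simp

variable [CompleteSpace H]

theorem norm_adjoint_apply_sub_sq_le (a : H →L[ℂ] H) {v : H} (hv : ‖v‖ = 1) :
    ‖ContinuousLinearMap.adjoint a (a v) - ((‖a‖ ^ 2 : ℝ) : ℂ) • v‖ ^ 2
      ≤ ‖a‖ ^ 2 * (‖a‖ ^ 2 - ‖a v‖ ^ 2) := by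
  have h1 : ‖ContinuousLinearMap.adjoint a (a v)‖ ≤ ‖a‖ * ‖a v‖ := by
    have := (ContinuousLinearMap.adjoint a).le_opNorm (a v)
    rwa [LinearIsometryEquiv.norm_map] at this
  have h2 := pow_le_pow_left₀ (norm_nonneg _) h1 2
  rw [norm_sub_sq (𝕜 := ℂ), inner_smul_right, ContinuousLinearMap.adjoint_inner_left,
    inner_self_eq_norm_sq_to_K, norm_smul, hv, Complex.norm_real, Real.norm_of_nonneg (by positivity)]
  have h3 : RCLike.re (((‖a‖ ^ 2 : ℝ) : ℂ) * ((‖a v‖ : ℝ) : ℂ) ^ 2) = ‖a‖ ^ 2 * ‖a v‖ ^ 2 := by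
    rw [RCLike.re_eq_complex_re]
    norm_cast
  erw [h3]
  nlinarith

theorem adjoint_apply_eq_of_norm_eq (a : H →L[ℂ] H) {v : H} (hv : ‖v‖ = 1) (hav : ‖a v‖ = ‖a‖) :
    ContinuousLinearMap.adjoint a (a v) = ((‖a‖ ^ 2 : ℝ) : ℂ) • v := by
  have h := norm_adjoint_apply_sub_sq_le a hv
  rw [hav, sub_self, mul_zero] at h
  exact sub_eq_zero.1 (norm_eq_zero.1 (pow_eq_zero_iff two_ne_zero |>.1 (h.antisymm (sq_nonneg _))))

theorem inner_apply_eq_zero_of_norm_eq (a : H →L[ℂ] H) {v u : H} (hv : ‖v‖ = 1)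
    (hav : ‖a v‖ = ‖a‖) (hu : ⟪v, u⟫_ℂ = 0) : ⟪a v, a u⟫_ℂ = 0 := by
  rw [← ContinuousLinearMap.adjoint_inner_left, adjoint_apply_eq_of_norm_eq a hv hav,
    inner_smul_left, hu, mul_zero]

theorem IsCompactOperator.exists_norm_apply_eq [Nontrivial H] {a : H →L[ℂ] H}
    (ha : IsCompactOperator a) : ∃ v : H, ‖v‖ = 1 ∧ ‖a v‖ = ‖a‖ := by
  rcases eq_or_ne a 0 with rfl | ha0
  · obtain ⟨v, hv⟩ := exists_norm_eq H zero_le_one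
    exact ⟨v, hv, by simp⟩
  have hpos : 0 < ‖a‖ := norm_pos_iff.2 ha0
  have hex : ∀ m : ℕ, ∃ v : H, ‖v‖ = 1 ∧ ‖a‖ - 1 / ((m : ℝ) + 1) ≤ ‖a v‖ := by
    intro m
    by_contra! hcon
    have hm : (0 : ℝ) < 1 / ((m : ℝ) + 1) := by positivity
    obtain ⟨v₀, hv₀⟩ := exists_norm_eq H zero_le_one
    have hnn : 0 ≤ ‖a‖ - 1 / ((m : ℝ) + 1) := (norm_nonneg _).trans (hcon v₀ hv₀).le
    have := a.opNorm_le_bound hnn fun x => by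
      rcases eq_or_ne x 0 with rfl | hx
      · simp
      have hx' : 0 < ‖x‖ := norm_pos_iff.2 hx
      have h1 := (hcon (((‖x‖⁻¹ : ℝ) : ℂ) • x) (by
        rw [norm_smul, Complex.norm_real, norm_inv, norm_norm, inv_mul_cancel₀ hx'.ne'])).le
      rw [map_smul, norm_smul, Complex.norm_real, norm_inv, norm_norm,
        inv_mul_le_iff₀ hx'] at h1
      linarith
    linarith
  choose v hv hav using hex
  have hlim : Tendsto (fun m => ‖a (v m)‖) atTop (𝓝 ‖a‖) := by
    refine tendsto_of_tendsto_of_tendsto_of_le_of_le (g := fun m : ℕ => ‖a‖ - 1 / ((m : ℝ) + 1))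
      ?_ tendsto_const_nhds hav fun m => ?_
    · simpa using (tendsto_const_nhds (x := ‖a‖)).sub
        (tendsto_one_div_add_atTop_nhds_zero_nat (𝕜 := ℝ))
    · simpa [hv m] using a.le_opNorm (v m)
  obtain ⟨w, -, φ, hφ, hw⟩ := (ha.isCompact_closure_image_closedBall 1).tendsto_subseq
    (x := fun m => a (v m)) fun m => subset_closure ⟨v m, by simp [hv m], rfl⟩
  have hdiff : Tendsto (fun m => ContinuousLinearMap.adjoint a (a (v m))
      - ((‖a‖ ^ 2 : ℝ) : ℂ) • v m) atTop (𝓝 0) := by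
    have h1 : Tendsto (fun m => ‖a‖ ^ 2 * (‖a‖ ^ 2 - ‖a (v m)‖ ^ 2)) atTop (𝓝 0) := by
      have := (tendsto_const_nhds (x := ‖a‖ ^ 2)).mul
        ((tendsto_const_nhds (x := ‖a‖ ^ 2)).sub (hlim.pow 2))
      rwa [sub_self, mul_zero] at this
    have h2 := squeeze_zero (fun m => sq_nonneg _)
      (fun m => norm_adjoint_apply_sub_sq_le a (hv m)) h1
    rw [tendsto_zero_iff_norm_tendsto_zero]
    simpa using h2.sqrt
  have hc : ((‖a‖ ^ 2 : ℝ) : ℂ) ≠ 0 := by exact_mod_cast (pow_pos hpos 2).ne'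
  have hconv : Tendsto (fun m => v (φ m)) atTop
      (𝓝 (((‖a‖ ^ 2 : ℝ) : ℂ)⁻¹ • ContinuousLinearMap.adjoint a w)) := by
    have h1 := (((ContinuousLinearMap.adjoint a).continuous.tendsto w).comp hw).sub
      (hdiff.comp hφ.tendsto_atTop)
    have h2 := h1.const_smul (((‖a‖ ^ 2 : ℝ) : ℂ)⁻¹)
    rw [sub_zero] at h2
    refine h2.congr fun m => ?_
    simp only [Function.comp_apply]
    rw [sub_sub_cancel, inv_smul_smul₀ hc]
  exact ⟨_, tendsto_nhds_unique hconv.norm (by simp [hv]),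
    tendsto_nhds_unique ((a.continuous.tendsto _).comp hconv).norm
      (hlim.comp hφ.tendsto_atTop)⟩

theorem exists_subspace_of_deflation {a : H →L[ℂ] H} {v : H} (hv : ‖v‖ = 1) (hav : ‖a v‖ = ‖a‖)
    {k : ℕ} {c : ℝ} (hc : 0 < c) (V : Submodule ℂ H) (hV : k < finrank ℂ V)
    (h : ∀ u ∈ V, c * ‖u‖ ≤ ‖deflation a v u‖) :
    ∃ W : Submodule ℂ H, k + 1 < finrank ℂ W ∧ ∀ w ∈ W, c * ‖w‖ ≤ ‖a w‖ := by
  have : FiniteDimensional ℂ V := FiniteDimensional.of_finrank_pos (by omega)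
  have hvv : ⟪v, v⟫_ℂ = 1 := by simp [inner_self_eq_norm_sq_to_K, hv]
  let Q : H →ₗ[ℂ] H := (LinearMap.id - (rankOneOp v v : H →ₗ[ℂ] H))
  have hQ : ∀ x, Q x = x - ⟪v, x⟫_ℂ • v := fun x => rfl
  have hQv : ∀ x, ⟪v, Q x⟫_ℂ = 0 := fun x => by
    rw [hQ, inner_sub_right, inner_smul_right, hvv, mul_one, sub_self]
  have hQn : ∀ x, ‖Q x‖ ≤ ‖x‖ := fun x => by
    have h1 : x = ⟪v, x⟫_ℂ • v + Q x := by rw [hQ]; abel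
    have h2 := norm_add_sq_eq_norm_sq_add_norm_sq_of_inner_eq_zero (𝕜 := ℂ) (⟪v, x⟫_ℂ • v) (Q x)
      (by rw [inner_smul_left, hQv, mul_zero])
    rw [← h1] at h2
    exact abs_le_of_sq_le_sq' (by nlinarith [norm_nonneg (⟪v, x⟫_ℂ • v)]) (norm_nonneg _) |>.2
  have hQa : ∀ u ∈ V, c * ‖u‖ ≤ ‖a (Q u)‖ := fun u hu => by
    have := h u hu
    rwa [deflation_apply] at this
  have hca : c ≤ ‖a‖ := by
    have : Nontrivial V := Module.nontrivial_of_finrank_pos (R := ℂ) (by omega)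
    obtain ⟨u, hu⟩ := exists_ne (0 : V)
    have hu' : 0 < ‖(u : H)‖ := by simpa using hu
    refine le_of_mul_le_mul_right ?_ hu'
    exact (hQa u u.2).trans ((a.le_opNorm _).trans (by gcongr; exact hQn u))
  let L : (ℂ × V) →ₗ[ℂ] H :=
    (LinearMap.toSpanSingleton ℂ H v).coprod (Q ∘ₗ V.subtype)
  have hL : ∀ p, L p = p.1 • v + Q p.2 := fun p => rfl
  have hLn : ∀ p, ‖L p‖ ^ 2 = ‖p.1‖ ^ 2 + ‖Q p.2‖ ^ 2 := fun p => by
    have h2 := norm_add_sq_eq_norm_sq_add_norm_sq_of_inner_eq_zero (𝕜 := ℂ) (p.1 • v) (Q p.2)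
      (by rw [inner_smul_left, hQv, mul_zero])
    rw [norm_smul, hv, mul_one] at h2
    rw [hL, sq, h2, sq, sq]
  have haL : ∀ p, ‖a (L p)‖ ^ 2 = ‖a‖ ^ 2 * ‖p.1‖ ^ 2 + ‖a (Q p.2)‖ ^ 2 := fun p => by
    have h2 := norm_add_sq_eq_norm_sq_add_norm_sq_of_inner_eq_zero (𝕜 := ℂ) (p.1 • a v) (a (Q p.2))
      (by rw [inner_smul_left, inner_apply_eq_zero_of_norm_eq a hv hav (hQv _), mul_zero])
    rw [norm_smul, hav] at h2
    rw [hL, map_add, map_smul, sq, h2]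
    ring
  have hinj : Function.Injective L := by
    rw [← LinearMap.ker_eq_bot, LinearMap.ker_eq_bot']
    intro p hp
    have h1 := hLn p
    rw [hp, norm_zero] at h1
    have h2 : p.1 = 0 := by
      rw [← norm_eq_zero, ← sq_eq_zero_iff]
      nlinarith [sq_nonneg ‖p.1‖, sq_nonneg ‖Q p.2‖]
    have h3 : Q p.2 = 0 := by
      rw [← norm_eq_zero, ← sq_eq_zero_iff]
      nlinarith [sq_nonneg ‖p.1‖, sq_nonneg ‖Q p.2‖]
    have h4 := hQa p.2 p.2.2
    rw [h3, map_zero, norm_zero] at h4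
    have h5 : p.2 = 0 := by
      have : ‖(p.2 : H)‖ = 0 := by nlinarith [norm_nonneg (p.2 : H)]
      simpa using this
    exact Prod.ext h2 h5
  refine ⟨LinearMap.range L, ?_, ?_⟩
  · rw [LinearMap.finrank_range_of_inj hinj, finrank_prod, finrank_self]
    omega
  · rintro _ ⟨p, rfl⟩
    refine abs_le_of_sq_le_sq' ?_ (norm_nonneg _) |>.2
    have h1 : c * ‖Q p.2‖ ≤ ‖a (Q p.2)‖ :=
      (mul_le_mul_of_nonneg_left (hQn _) hc.le).trans (hQa p.2 p.2.2)
    have h2 := pow_le_pow_left₀ (by positivity) h1 2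
    have h3 := pow_le_pow_left₀ hc.le hca 2
    rw [mul_pow, hLn, haL]
    nlinarith [mul_le_mul_of_nonneg_right h3 (sq_nonneg ‖p.1‖)]

theorem IsCompactOperator.exists_subspace_sValue [Nontrivial H] (k : ℕ) :
    ∀ {a : H →L[ℂ] H}, IsCompactOperator a → 0 < sValue a k →
      ∃ V : Submodule ℂ H, k < finrank ℂ V ∧ ∀ u ∈ V, sValue a k * ‖u‖ ≤ ‖a u‖ := by
  induction k with
  | zero =>
    intro a ha _
    obtain ⟨v, hv, hav⟩ := ha.exists_norm_apply_eq
    have hv0 : v ≠ 0 := by rintro rfl; simp at hv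
    refine ⟨Submodule.span ℂ {v}, by rw [finrank_span_singleton hv0]; omega, ?_⟩
    intro u hu
    obtain ⟨c, rfl⟩ := Submodule.mem_span_singleton.1 hu
    rw [sValue_zero, map_smul, norm_smul, norm_smul, hv, hav]
    linarith
  | succ k ih =>
    intro a ha hpos
    obtain ⟨v, hv, hav⟩ := ha.exists_norm_apply_eq
    have hle := sValue_succ_le_sValue_deflation a v k
    obtain ⟨V, hV, h⟩ := ih (isCompactOperator_deflation ha v) (hpos.trans_le hle)
    obtain ⟨W, hW, h'⟩ := exists_subspace_of_deflation hv hav (hpos.trans_le hle) V hV h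
    exact ⟨W, hW, fun u hu => (mul_le_mul_of_nonneg_right hle (norm_nonneg _)).trans (h' u hu)⟩

theorem IsCompactOperator.sValue_deflation [Nontrivial H] {a : H →L[ℂ] H}
    (ha : IsCompactOperator a) {v : H} (hv : ‖v‖ = 1) (hav : ‖a v‖ = ‖a‖) (k : ℕ) :
    sValue (deflation a v) k = sValue a (k + 1) := by
  refine le_antisymm ?_ (sValue_succ_le_sValue_deflation a v k)
  rcases (sValue_nonneg (deflation a v) k).eq_or_lt with h0 | hpos
  · rw [← h0]
    exact sValue_nonneg _ _
  obtain ⟨V, hV, h⟩ := (isCompactOperator_deflation ha v).exists_subspace_sValue k hpos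
  obtain ⟨W, hW, h'⟩ := exists_subspace_of_deflation hv hav hpos V hV h
  exact le_sValue_of_subspace W hW h'

theorem MemTraceClass.deflation [Nontrivial H] {a : H →L[ℂ] H} (ha : MemTraceClass a) {v : H}
    (hv : ‖v‖ = 1) (hav : ‖a v‖ = ‖a‖) : MemTraceClass (deflation a v) := by
  refine ⟨isCompactOperator_deflation ha.1 v, ?_⟩
  simp only [ha.1.sValue_deflation hv hav]
  exact (summable_nat_add_iff 1).2 ha.2

theorem MemTraceClass.norm_add_traceNorm_deflation [Nontrivial H] {a : H →L[ℂ] H}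
    (ha : MemTraceClass a) {v : H} (hv : ‖v‖ = 1) (hav : ‖a v‖ = ‖a‖) :
    ‖a‖ + traceNorm (_root_.deflation a v) = traceNorm a := by
  simp only [traceNorm, ha.1.sValue_deflation hv hav]
  rw [ha.2.tsum_eq_zero_add, sValue_zero]

theorem eq_rankOneOp_of_norm_apply_eq_one [Nontrivial H] {a : H →L[ℂ] H} (ha : a ∈ traceBall H)
    {v : H} (hv : ‖v‖ = 1) (hav : ‖a v‖ = 1) : a = rankOneOp (a v) v := by
  have h1 : ‖a‖ = 1 := ((ha.1.norm_le_traceNorm).trans ha.2).antisymm <| by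
    simpa [hav, hv] using a.le_opNorm v
  have h2 := ha.1.norm_add_traceNorm_deflation hv (hav.trans h1.symm)
  have h3 := (ha.1.deflation hv (hav.trans h1.symm)).norm_le_traceNorm
  have h4 : ‖deflation a v‖ = 0 := le_antisymm (by linarith [ha.2]) (norm_nonneg _)
  exact sub_eq_zero.1 (norm_eq_zero.1 h4)

theorem rankOneOp_self_mem_extremePoints {ξ : H} (hξ : ‖ξ‖ = 1) :
    rankOneOp ξ ξ ∈ Set.extremePoints ℝ (traceBall H) := by
  have : Nontrivial H := ⟨ξ, 0, by rintro rfl; simp at hξ⟩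
  rw [mem_extremePoints_iff_left]
  refine ⟨rankOneOp_mem_traceBall hξ hξ, fun x hx y hy hmem => ?_⟩
  have hbound : ∀ z ∈ traceBall H, ‖z ξ‖ ≤ 1 := fun z hz => by
    have := z.le_opNorm ξ
    rw [hξ, mul_one] at this
    exact this.trans (hz.1.norm_le_traceNorm.trans hz.2)
  have hre : ∀ z ∈ traceBall H, (⟪ξ, z ξ⟫_ℂ).re ≤ 1 := fun z hz => by
    refine (Complex.re_le_norm _).trans ((norm_inner_le_norm _ _).trans ?_)
    rw [hξ, one_mul]
    exact hbound z hz
  obtain ⟨s, t, hs, ht, hst, h⟩ := hmem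
  have h1 : s * (⟪ξ, x ξ⟫_ℂ).re + t * (⟪ξ, y ξ⟫_ℂ).re = 1 := by
    have h2 := congrArg (fun z : H →L[ℂ] H => (⟪ξ, z ξ⟫_ℂ).re) h
    simpa [rankOneOp_apply, hξ, inner_add_right, inner_smul_right_eq_smul] using h2
  have hx1 : (⟪ξ, x ξ⟫_ℂ).re = 1 := by
    refine (hre x hx).antisymm (le_of_mul_le_mul_left ?_ hs)
    nlinarith [hre y hy]
  have hxξ : ξ = x ξ := eq_of_re_inner_eq_one hξ.le (hbound x hx) hx1
  have h2 := eq_rankOneOp_of_norm_apply_eq_one hx hξ (by rw [← hxξ, hξ])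
  rwa [← hxξ] at h2

theorem exists_rankOneOp_of_mem_extremePoints [Nontrivial H] {e : H →L[ℂ] H}
    (he : e ∈ Set.extremePoints ℝ (traceBall H)) :
    ∃ η ξ : H, ‖η‖ = 1 ∧ ‖ξ‖ = 1 ∧ e = rankOneOp η ξ := by
  rw [mem_extremePoints_iff_left] at he
  obtain ⟨heB, hext⟩ := he
  obtain ⟨v, hv, hev⟩ := heB.1.1.exists_norm_apply_eq
  have hle : ‖e‖ ≤ 1 := heB.1.norm_le_traceNorm.trans heB.2
  rcases (norm_nonneg e).eq_or_lt with h0 | hpos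
  · have he0 : e = 0 := norm_eq_zero.1 h0.symm
    have hneg : ‖-v‖ = 1 := by rw [norm_neg, hv]
    have h1 := hext _ (rankOneOp_mem_traceBall hv hv) _ (rankOneOp_mem_traceBall hneg hv)
      ⟨1 / 2, 1 / 2, by norm_num, by norm_num, by norm_num, by
        ext x; simp [rankOneOp_apply, he0]⟩
    have h2 := norm_rankOneOp v v
    rw [h1, he0, norm_zero, hv] at h2
    norm_num at h2
  rcases hle.eq_or_lt with h1 | hlt
  · exact ⟨e v, v, hev.trans h1, hv, eq_rankOneOp_of_norm_apply_eq_one heB hv (hev.trans h1)⟩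
  have hη : ‖‖e‖⁻¹ • e v‖ = 1 := by
    rw [norm_smul, norm_inv, norm_norm, hev, inv_mul_cancel₀ hpos.ne']
  have hd : (1 - ‖e‖)⁻¹ • deflation e v ∈ traceBall H := by
    refine ⟨(heB.1.deflation hv hev).smul _, ?_⟩
    have h2 := heB.1.norm_add_traceNorm_deflation hv hev
    rw [traceNorm_smul, abs_of_pos (inv_pos.2 (sub_pos.2 hlt)), inv_mul_le_iff₀ (sub_pos.2 hlt)]
    linarith [heB.2]
  refine ⟨_, v, hη, hv, (hext _ (rankOneOp_mem_traceBall hη hv) _ hd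
    ⟨‖e‖, 1 - ‖e‖, hpos, sub_pos.2 hlt, by ring, ?_⟩).symm⟩
  rw [smul_inv_smul₀ (sub_pos.2 hlt).ne']
  have h3 : ‖e‖ • rankOneOp (‖e‖⁻¹ • e v) v = rankOneOp (e v) v := by
    ext x
    simp only [smul_apply, rankOneOp_apply]
    rw [smul_comm ‖e‖, smul_inv_smul₀ hpos.ne']
  rw [h3, deflation]
  abel

theorem Orthonormal.sum_norm_inner_apply_le_sum_sValue [Nontrivial H] {b : ι → H}
    (hb : Orthonormal ℂ b) (N : ℕ) : ∀ {a : H →L[ℂ] H}, IsCompactOperator a →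
      ∑ i, ‖⟪b i, a (b i)⟫_ℂ‖
        ≤ ∑ k ∈ Finset.range N, sValue a k + Fintype.card ι * sValue a N := by
  induction N with
  | zero =>
    intro a _
    have h : ∀ i ∈ Finset.univ, ‖⟪b i, a (b i)⟫_ℂ‖ ≤ ‖a‖ := fun i _ => by
      have h1 := a.le_opNorm (b i)
      have h2 := norm_inner_le_norm (𝕜 := ℂ) (b i) (a (b i))
      rw [hb.1 i] at h1 h2
      linarith
    simpa [sValue_zero] using Finset.sum_le_card_nsmul _ _ _ h
  | succ N ih =>
    intro a ha
    obtain ⟨v, hv, hav⟩ := ha.exists_norm_apply_eq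
    have h1 := ih (isCompactOperator_deflation ha v)
    have h2 := hb.sum_norm_inner_rankOneOp_le (a v) v
    simp only [ha.sValue_deflation hv hav] at h1
    rw [hv, hav, mul_one] at h2
    have h3 : ∑ i, ‖⟪b i, a (b i)⟫_ℂ‖ ≤ ∑ i, ‖⟪b i, rankOneOp (a v) v (b i)⟫_ℂ‖
        + ∑ i, ‖⟪b i, deflation a v (b i)⟫_ℂ‖ := by
      rw [← Finset.sum_add_distrib]
      refine Finset.sum_le_sum fun i _ => ?_
      have h4 : a (b i) = rankOneOp (a v) v (b i) + deflation a v (b i) := by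
        simp [deflation]
      conv_lhs => rw [h4, inner_add_right]
      exact norm_add_le _ _
    rw [Finset.sum_range_succ', sValue_zero]
    linarith

theorem Orthonormal.sum_norm_inner_apply_le_traceNorm [Nontrivial H] {b : ι → H}
    (hb : Orthonormal ℂ b) {a : H →L[ℂ] H} (ha : MemTraceClass a) :
    ∑ i, ‖⟪b i, a (b i)⟫_ℂ‖ ≤ traceNorm a := by
  have h := ha.2.hasSum.tendsto_sum_nat.add
    (ha.2.tendsto_atTop_zero.const_mul (Fintype.card ι : ℝ))
  rw [mul_zero, add_zero] at h
  exact ge_of_tendsto' h fun N => hb.sum_norm_inner_apply_le_sum_sValue N ha.1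

/-- The normalized projection onto an `n`-dimensional subspace has no amenable triplet with
parameter larger than `1 / n`. -/

theorem le_inv_finrank_of_amenable [Nontrivial H] (S : Submodule ℂ H) [FiniteDimensional ℂ S]
    {e y : H →L[ℂ] H} {t : ℝ} (ht : t ∈ Set.Icc (0 : ℝ) 1)
    (he : e ∈ Set.extremePoints ℝ (traceBall H)) (hy : y ∈ traceBall H)
    (hS : 0 < finrank ℂ S)
    (h : (finrank ℂ S : ℝ)⁻¹ • S.starProjection = t • e + (1 - t) • y) :
    t ≤ (finrank ℂ S : ℝ)⁻¹ := by
  have hn : (finrank ℂ S : ℝ) ≠ 0 := by exact_mod_cast hS.ne'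
  rcases ht.1.eq_or_lt with rfl | htpos
  · positivity
  have hd : ∀ b : S, ‖b‖ = 1 → (finrank ℂ S : ℝ)⁻¹
      = t * (⟪(b : H), e b⟫_ℂ).re + (1 - t) * (⟪(b : H), y b⟫_ℂ).re := fun b hb => by
    have h1 := congrArg (fun z : H →L[ℂ] H => (⟪(b : H), z b⟫_ℂ).re) h
    have hb' : ‖(b : H)‖ = 1 := hb
    simpa [inner_add_right, inner_smul_right_eq_smul, hb',
      Submodule.starProjection_eq_self_iff.2 b.2] using h1
  have hsum : ∀ b : OrthonormalBasis (Fin (finrank ℂ S)) ℂ S,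
      1 = t * ∑ i, (⟪(b i : H), e (b i)⟫_ℂ).re + (1 - t) * ∑ i, (⟪(b i : H), y (b i)⟫_ℂ).re :=
    fun b => by
      rw [Finset.mul_sum, Finset.mul_sum, ← Finset.sum_add_distrib,
        ← Finset.sum_congr rfl fun i _ => hd (b i) (b.norm_eq_one i)]
      simp [hn]
  have hort : ∀ b : OrthonormalBasis (Fin (finrank ℂ S)) ℂ S,
      Orthonormal ℂ (fun i => (b i : H)) := fun b =>
    b.orthonormal.comp_linearIsometry S.subtypeₗᵢ
  have hle : ∀ b : OrthonormalBasis (Fin (finrank ℂ S)) ℂ S, ∀ z ∈ traceBall H,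
      ∑ i, ‖⟪(b i : H), z (b i)⟫_ℂ‖ ≤ 1 := fun b z hz =>
    ((hort b).sum_norm_inner_apply_le_traceNorm hz.1).trans hz.2
  obtain ⟨η, ζ, hη, hζ, rfl⟩ := exists_rankOneOp_of_mem_extremePoints he
  have hζS : η = ζ ∧ ζ ∈ S := by
    let b := stdOrthonormalBasis ℂ S
    have hre : ∀ z ∈ traceBall H, ∑ i, (⟪(b i : H), z (b i)⟫_ℂ).re ≤ 1 := fun z hz =>
      (Finset.sum_le_sum fun i _ => Complex.re_le_norm _).trans (hle b z hz)
    have h1 : ∑ i, (⟪(b i : H), rankOneOp η ζ (b i)⟫_ℂ).re = 1 := by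
      refine (hre _ he.1).antisymm (le_of_mul_le_mul_left ?_ htpos)
      nlinarith [hsum b, mul_le_mul_of_nonneg_left (hre y hy) (sub_nonneg.2 ht.2)]
    have h2 : S.starProjection η = ∑ i, ⟪(b i : H), η⟫_ℂ • (b i : H) := by
      simpa using congrArg Subtype.val (b.orthogonalProjectionOnto_apply_eq_sum η)
    have h3 : (⟪ζ, S.starProjection η⟫_ℂ).re = 1 := by
      rw [← h1, h2, inner_sum, Complex.re_sum]
      refine Finset.sum_congr rfl fun i _ => ?_
      rw [inner_smul_right, rankOneOp_apply, inner_smul_right, mul_comm]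
    have hP : ∀ x, ‖x‖ = 1 → ‖S.starProjection x‖ ≤ 1 := fun x hx => by
      simpa [hx] using S.starProjection.le_of_opNorm_le S.starProjection_norm_le x
    have h4 := eq_of_re_inner_eq_one hζ.le (hP η hη) h3
    have h5 : ζ ∈ S := h4 ▸ S.starProjection_apply_mem η
    refine ⟨(eq_of_re_inner_eq_one hζ.le hη.le ?_).symm, h5⟩
    rw [← h3, ← S.inner_starProjection_left_eq_right, Submodule.starProjection_eq_self_iff.2 h5]
  obtain ⟨rfl, hηS⟩ := hζS
  have hηη : ⟪η, η⟫_ℂ = 1 := by simp [inner_self_eq_norm_sq_to_K, hη]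
  let i₀ : Fin (finrank ℂ S) := ⟨0, hS⟩
  obtain ⟨b, hb⟩ := Orthonormal.exists_orthonormalBasis_extension_of_card_eq (𝕜 := ℂ) (E := S)
    (ι := Fin (finrank ℂ S)) (by simp) (v := fun _ => (⟨η, hηS⟩ : S)) (s := {i₀}) (by
      rw [orthonormal_iff_ite]
      rintro ⟨i, rfl⟩ ⟨j, rfl⟩
      simpa [Set.domRestrict] using hηη)
  have hb₀ : (b i₀ : H) = η := congrArg Subtype.val (hb i₀ rfl)
  have he₀ : ⟪(b i₀ : H), rankOneOp η η (b i₀)⟫_ℂ = 1 := by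
    rw [hb₀, rankOneOp_apply, hηη, one_smul, hηη]
  have hesum : ∑ i, (⟪(b i : H), rankOneOp η η (b i)⟫_ℂ).re = 1 := by
    rw [Finset.sum_eq_single i₀ _ (by simp), he₀, Complex.one_re]
    intro i _ hi
    rw [rankOneOp_apply, ← hb₀, (hort b).2 hi.symm, zero_smul, inner_zero_right, Complex.zero_re]
  have hs := hsum b
  have h₀ := hd (b i₀) (b.norm_eq_one i₀)
  have hys := hle b y hy
  rw [hesum] at hs
  rw [he₀, Complex.one_re] at h₀
  have hyre : ∑ i, (⟪(b i : H), y (b i)⟫_ℂ).re ≤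
      ∑ i, ‖⟪(b i : H), y (b i)⟫_ℂ‖ + (⟪(b i₀ : H), y (b i₀)⟫_ℂ).re := by
    rw [← Finset.add_sum_erase _ _ (Finset.mem_univ i₀),
      ← Finset.add_sum_erase (a := i₀) _ (fun i => ‖⟪(b i : H), y (b i)⟫_ℂ‖) (Finset.mem_univ i₀)]
    have := Finset.sum_le_sum (s := Finset.univ.erase i₀) fun i _ =>
      Complex.re_le_norm ⟪(b i : H), y (b i)⟫_ℂ
    linarith [norm_nonneg ⟪(b i₀ : H), y (b i₀)⟫_ℂ]
  nlinarith [mul_le_mul_of_nonneg_left (hyre.trans (add_le_add_left hys _)) (sub_nonneg.2 ht.2)]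

end

/-- Let `H` be a complex Hilbert space, `n ≥ 1`, let `ξ₁, …, ξₙ` be an
orthonormal system in `H` and let `aₙ = ∑_{k=1}^n (1/n) ξ_k ⊗ ξ_k`. Then `‖aₙ‖₁ = 1`,
`‖aₙ‖_∞ = 1/n` and `λ(aₙ) = 1/n`. -/
theorem lambdaFn_of_average_of_rank_ones {H : Type*} [NormedAddCommGroup H]
    [InnerProductSpace ℂ H] [CompleteSpace H] (n : ℕ) (hn : 0 < n)
    (ξ : Fin n → H) (hξ : Orthonormal ℂ ξ) (a : H →L[ℂ] H)
    (ha : a = ∑ k, ((n : ℝ)⁻¹) • rankOneOp (ξ k) (ξ k)) :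
    traceNorm a = 1 ∧ ‖a‖ = 1 / n ∧ lambdaFn a = 1 / n := by

  have hn' : (n : ℝ) ≠ 0 := by exact_mod_cast hn.ne'
  let S := Submodule.span ℂ (Set.range ξ)
  have : FiniteDimensional ℂ S := FiniteDimensional.span_of_finite ℂ (Set.finite_range ξ)
  have hS : Module.finrank ℂ S = n := by
    simpa using finrank_span_eq_card hξ.linearIndependent
  have haS : a = (n : ℝ)⁻¹ • S.starProjection := by
    rw [ha, ← Finset.smul_sum, hξ.sum_rankOneOp_eq_starProjection]
  have hc : 0 ≤ (n : ℝ)⁻¹ := by positivity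
  have : Nontrivial H := ⟨ξ ⟨0, hn⟩, 0, hξ.ne_zero _⟩
  refine ⟨?_, ?_, ?_⟩
  · rw [haS, traceNorm_smul_starProjection S hc, hS, mul_inv_cancel₀ hn']
  · rw [haS, ← sValue_zero, sValue_smul_starProjection S hc, if_pos (by omega), one_div]
  rw [one_div]
  refine IsGreatest.csSup_eq ⟨⟨⟨hc, Nat.cast_inv_le_one n⟩, ?_⟩, ?_⟩
  · obtain ⟨m, rfl⟩ : ∃ m, n = m + 1 := ⟨n - 1, by omega⟩
    have hξ' : Orthonormal ℂ (fun k : Fin m => ξ k.succ) := hξ.comp _ (Fin.succ_injective m)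
    let S' := Submodule.span ℂ (Set.range fun k : Fin m => ξ k.succ)
    have : FiniteDimensional ℂ S' := FiniteDimensional.span_of_finite ℂ (Set.finite_range _)
    have hS' : Module.finrank ℂ S' = m := by
      simpa using finrank_span_eq_card hξ'.linearIndependent
    have hm : 0 ≤ (m : ℝ)⁻¹ := by positivity
    refine ⟨_, rankOneOp_self_mem_extremePoints (hξ.1 0), (m : ℝ)⁻¹ • S'.starProjection,
      ⟨memTraceClass_smul_starProjection S' hm, ?_⟩, ?_⟩
    · rw [traceNorm_smul_starProjection S' hm, hS']
      exact mul_inv_le_one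
    · rw [ha, Fin.sum_univ_succ, ← Finset.smul_sum, smul_smul,
        show S'.starProjection = _ from hξ'.sum_rankOneOp_eq_starProjection.symm]
      congr 1
      rcases Nat.eq_zero_or_pos m with rfl | hm0
      · simp
      · congr 1
        push_cast
        have : (m : ℝ) ≠ 0 := by exact_mod_cast hm0.ne'
        field_simp
        ring
  · rintro t ⟨ht, e, he, y, hy, h⟩
    rw [← hS]
    exact le_inv_finrank_of_amenable S ht he hy (by omega) (by rw [hS, ← haS, h])
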